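/- arXiv:2207.07993 — 3 statements merged into one kernel-verified Lean document; each statement's English description precedes it below -/
import Mathlib

section
/- Let n, m ∈ ℕ and let r : Fin n → ℝ³ be a family of vectors (the relative positions of tags 2,…,n+1 with respect to the reference tag 1). Let R : (Fin n → ℝ³) →ₗ[ℝ] (Fin m → ℝ) be a linear map (the rigidity matrix of an infinitesimally rigid graph) whose kernel equals the span of the three vectors v₀, v₁, v₂, where v_b : Fin n → ℝ³ is defined by v_b k = −((r k) × e_b). If j, ℓ ∈ Fin n are indices such that the vectors r j and r ℓ are linearly independent over ℝ, then any x : Fin n → ℝ³ satisfying R x = 0, x j = 0 and x ℓ = 0 must be x = 0; i.e., the augmented linear map x ↦ (R x, x j, x ℓ) is injective (the system with the two additional relative-position measurements is instantaneously locally observable). -/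
open Matrix

/-- **Theorem 1 (sufficient condition for instantaneous local observability).**
Given an infinitesimally rigid graph whose rigidity matrix `R` has kernel spanned by the
rotational directions `v b k = -((r k) ×₃ e b)`, directly measuring two linearly independent
relative position vectors `r j`, `r ℓ` makes the system locally observable: the augmented
map `x ↦ (R x, x j, x ℓ)` is injective. -/
theorem rigidity_two_relative_measurements_observable
    (n m : ℕ) (r : Fin n → Fin 3 → ℝ)
    (R : (Fin n → Fin 3 → ℝ) →ₗ[ℝ] (Fin m → ℝ))
    (v : Fin 3 → Fin n → Fin 3 → ℝ)
    (hv : ∀ b k, v b k = -(crossProduct (r k) (Pi.single b 1)))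
    (hker : LinearMap.ker R = Submodule.span ℝ ({v 0, v 1, v 2} : Set (Fin n → Fin 3 → ℝ)))
    (j ℓ : Fin n) (hindep : LinearIndependent ℝ ![r j, r ℓ]) :
    ∀ x : Fin n → Fin 3 → ℝ, R x = 0 → x j = 0 → x ℓ = 0 → x = 0 := by
  intro x hx hj hl
  have hmem : x ∈ Submodule.span ℝ ({v 0, v 1, v 2} : Set (Fin n → Fin 3 → ℝ)) := by
    rw [← hker]; exact hx
  obtain ⟨a, b, c, habc⟩ := Submodule.mem_span_triple.1 hmem
  have key : ∀ k, x k = -(crossProduct (r k) ![a, b, c]) := by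
    intro k
    rw [← habc]
    simp only [Pi.add_apply, Pi.smul_apply, hv]
    ext i
    fin_cases i <;> simp [cross_apply] <;> ring
  have par : ∀ k, r k ≠ 0 → x k = 0 → ∃ s : ℝ, s • r k = ![a, b, c] := by
    intro k hk h0
    by_contra! hne
    have h1 := (LinearIndependent.pair_iff' hk).2 hne
    have h2 := crossProduct_ne_zero_iff_linearIndependent.2 h1
    rw [key k] at h0
    exact h2 (neg_eq_zero.1 h0)
  obtain ⟨s, hs⟩ := par j (by simpa using hindep.ne_zero 0) hj
  obtain ⟨t, ht⟩ := par ℓ (by simpa using hindep.ne_zero 1) hl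
  have hst := LinearIndependent.pair_iff.1 hindep s (-t) (by rw [neg_smul, hs, ht]; simp)
  have hw : ![a, b, c] = 0 := by rw [← hs, hst.1, zero_smul]
  funext k
  rw [key k, hw]
  simp
end

section
/- Let n, m ∈ ℕ and let r : Fin n → ℝ³ be a family of vectors (the positions of tags 2,…,n+1 relative to the reference tag 1); extend r to r̂ : Fin (n+1) → ℝ³ by r̂ 0 = 0 and r̂ (k+1) = r k, and similarly extend any state x : Fin n → ℝ³ to x̂ with x̂ 0 = 0. Let R : (Fin n → ℝ³) →ₗ[ℝ] (Fin m → ℝ) be a linear map whose kernel equals the span of the three vectors v₀, v₁, v₂, where v_b k = −((r k) × e_b). Suppose j₁, j₂, ℓ₁, ℓ₂ ∈ Fin (n+1) are indices (the pairs of tags carried by two two-tag agents) such that the vectors r̂ j₂ − r̂ j₁ and r̂ ℓ₂ − r̂ ℓ₁ are linearly independent over ℝ. Then any x : Fin n → ℝ³ satisfying R x = 0, x̂ j₂ − x̂ j₁ = 0 and x̂ ℓ₂ − x̂ ℓ₁ = 0 must be x = 0; i.e., the system augmented with the two known inter-tag displacement vectors is instantaneously locally observable. -/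
open Matrix

/-- Extension of the `n` relative positions to `n + 1` tag positions, placing the
reference tag (tag `0`) at the origin. -/
def extendRef (n : ℕ) (x : Fin n → Fin 3 → ℝ) : Fin (n + 1) → Fin 3 → ℝ :=
  Fin.cons 0 x

/-- A vector whose cross product with two independent vectors vanishes is zero. -/
theorem eq_zero_of_cross_eq_zero (d e w : Fin 3 → ℝ) (h : LinearIndependent ℝ ![d, e])
    (h1 : crossProduct d w = 0) (h2 : crossProduct e w = 0) : w = 0 := by
  have hne := crossProduct_ne_zero_iff_linearIndependent.mpr h
  by_contra hw
  apply hne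
  obtain ⟨i, hi⟩ : ∃ i, w i ≠ 0 := by
    by_contra hc
    push Not at hc
    exact hw (funext hc)
  have a0 := congrFun h1 0
  have a1 := congrFun h1 1
  have a2 := congrFun h1 2
  have b0 := congrFun h2 0
  have b1 := congrFun h2 1
  have b2 := congrFun h2 2
  simp [cross_apply] at a0 a1 a2 b0 b1 b2
  funext k
  apply mul_left_cancel₀ hi
  fin_cases i <;> fin_cases k <;> simp [cross_apply] <;> grind

theorem extendRef_cross (n : ℕ) (r x : Fin n → Fin 3 → ℝ) (w : Fin 3 → ℝ)
    (h : ∀ k, x k = -(crossProduct (r k) w)) (j : Fin (n + 1)) :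
    extendRef n x j = -(crossProduct (extendRef n r j) w) := by
  refine Fin.cases ?_ (fun k => ?_) j
  · simp [extendRef]
  · simp [extendRef, h]

/-- **Corollary 1 (two-tag agents).**
With `r̂ := extendRef n r` extending the relative tag positions by the reference tag at the
origin, if the rigidity-matrix kernel is spanned by the rotational directions and two
inter-tag displacement vectors `r̂ j₂ - r̂ j₁`, `r̂ ℓ₂ - r̂ ℓ₁` (known from the attitudes of two
two-tag agents) are linearly independent, then the augmented system is locally observable. -/
theorem two_tag_agents_observable
    (n m : ℕ) (r : Fin n → Fin 3 → ℝ)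
    (R : (Fin n → Fin 3 → ℝ) →ₗ[ℝ] (Fin m → ℝ))
    (v : Fin 3 → Fin n → Fin 3 → ℝ)
    (hv : ∀ b k, v b k = -(crossProduct (r k) (Pi.single b 1)))
    (hker : LinearMap.ker R = Submodule.span ℝ ({v 0, v 1, v 2} : Set (Fin n → Fin 3 → ℝ)))
    (j₁ j₂ ℓ₁ ℓ₂ : Fin (n + 1))
    (hindep : LinearIndependent ℝ
      ![extendRef n r j₂ - extendRef n r j₁, extendRef n r ℓ₂ - extendRef n r ℓ₁]) :
    ∀ x : Fin n → Fin 3 → ℝ, R x = 0 →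
      extendRef n x j₂ - extendRef n x j₁ = 0 →
      extendRef n x ℓ₂ - extendRef n x ℓ₁ = 0 → x = 0 := by
  intro x hx h1 h2
  have hm : x ∈ LinearMap.ker R := hx
  rw [hker, Submodule.mem_span_triple] at hm
  obtain ⟨a, b, c, habc⟩ := hm
  have hxw : ∀ k, x k = -(crossProduct (r k) ![a, b, c]) := by
    intro k
    have hw : ![a, b, c] = a • (Pi.single 0 1 : Fin 3 → ℝ) + b • (Pi.single 1 1 : Fin 3 → ℝ)
        + c • (Pi.single 2 1 : Fin 3 → ℝ) := by
      funext i
      fin_cases i <;> simp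
    rw [← habc, hw]
    simp only [Pi.add_apply, Pi.smul_apply, hv, map_add, map_smul, smul_neg, neg_add]
  have key := extendRef_cross n r x _ hxw
  have hz : (![a, b, c] : Fin 3 → ℝ) = 0 := by
    apply eq_zero_of_cross_eq_zero _ _ _ hindep
    · rw [key, key] at h1
      rw [map_sub, LinearMap.sub_apply, ← neg_eq_zero, ← h1]
      abel
    · rw [key, key] at h2
      rw [map_sub, LinearMap.sub_apply, ← neg_eq_zero, ← h2]
      abel
  funext k
  rw [hxw k, hz]
  simp
end

section
/- Let n ∈ ℕ and r : Fin n → ℝ³. Suppose there exist indices k₁, k₂ ∈ Fin n such that r k₁ and r k₂ are linearly independent over ℝ. Then the three vectors v₀, v₁, v₂ : Fin n → ℝ³, defined by v_b k = −((r k) × e_b) for b ∈ Fin 3, are linearly independent over ℝ. -/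
open Matrix

/-- Two independent vectors cannot both be parallel to a nonzero vector. -/
lemma eq_zero_of_parallel (a b g : Fin 3 → ℝ) (h : LinearIndependent ℝ ![a, b])
    (ha : ∀ i j, g i * a j = a i * g j) (hb : ∀ i j, g i * b j = b i * g j) (i : Fin 3) :
    g i = 0 := by
  by_contra hg
  rw [LinearIndependent.pair_iff] at h
  have h1 := h (b i) (-(a i)) (by
    ext j
    simp only [Pi.add_apply, Pi.smul_apply, smul_eq_mul, Pi.zero_apply]
    apply mul_left_cancel₀ hg
    linear_combination b i * ha i j - a i * hb i j)
  have h2 := h 1 0 (by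
    ext j
    simp only [Pi.add_apply, Pi.smul_apply, smul_eq_mul, Pi.zero_apply]
    apply mul_left_cancel₀ hg
    linear_combination ha i j - g j * h1.2)
  exact one_ne_zero h2.1

/-- If at least two of the relative tag positions `r k₁`, `r k₂` are linearly independent,
then the three rotational null directions `v b k = -((r k) × e b)` are linearly independent. -/
theorem rotational_directions_linearIndependent
    (n : ℕ) (r : Fin n → Fin 3 → ℝ) (k₁ k₂ : Fin n)
    (hindep : LinearIndependent ℝ ![r k₁, r k₂])
    (v : Fin 3 → Fin n → Fin 3 → ℝ)
    (hv : ∀ b k, v b k = -(crossProduct (r k) (Pi.single b 1))) :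
    LinearIndependent ℝ ![v 0, v 1, v 2] := by
  rw [Fintype.linearIndependent_iff]
  intro g hg
  have key : ∀ k i j, g i * r k j = r k i * g j := by
    intro k
    have h0 := congrFun (congrFun hg k) 0
    have h1 := congrFun (congrFun hg k) 1
    have h2 := congrFun (congrFun hg k) 2
    simp [Fin.sum_univ_three, hv, cross_apply, Pi.single_apply] at h0 h1 h2
    intro i j
    fin_cases i <;> fin_cases j <;> simp <;> linarith
  exact eq_zero_of_parallel _ _ g hindep (key k₁) (key k₂)
end
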